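/- For every n ≥ 1 and i_1, …, i_n ∈ {0, 1}: α ≤ Φ(ᵗA_{i_n} ⋯ ᵗA_{i_1}; α) ≤ Φ(ᵗA_{i_n} ⋯ ᵗA_{i_1}; β) ≤ β, where ᵗA denotes the transpose of A. In particular, r_n(x)/s_n(x) ∈ [α, β] for every n ≥ 1 and x ∈ [0, 1). -/

import Mathlib

open MeasureTheory Filter Set Matrix

noncomputable def Phi (a b c d z : ℝ) : ℝ := (a * z + b) / (c * z + d)

noncomputable def PhiM (M : Matrix (Fin 2) (Fin 2) ℝ) (z : ℝ) : ℝ :=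
  (M 0 0 * z + M 0 1) / (M 1 0 * z + M 1 1)

noncomputable def entS (p : ℝ) : ℝ := -(p * Real.log p) - (1 - p) * Real.log (1 - p)

noncomputable def Xdig (x : ℝ) (n : ℕ) : ℕ :=
  ⌊(2 : ℝ) ^ n * x⌋₊ - 2 * ⌊(2 : ℝ) ^ (n - 1) * x⌋₊

noncomputable def dyadI (x : ℝ) (n : ℕ) : Set ℝ :=
  Set.Ico ((⌊(2 : ℝ) ^ n * x⌋₊ : ℝ) / 2 ^ n) (((⌊(2 : ℝ) ^ n * x⌋₊ : ℝ) + 1) / 2 ^ n)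

noncomputable def matProd (A : ℕ → Matrix (Fin 2) (Fin 2) ℝ) (x : ℝ) (n : ℕ) :
    Matrix (Fin 2) (Fin 2) ℝ :=
  ((List.range n).map (fun j => A (Xdig x (j + 1)))).prod

noncomputable def Fcal (n : ℕ) : MeasurableSpace ℝ :=
  ⨆ i ∈ Finset.Icc 1 n, MeasurableSpace.comap (fun x : ℝ => Xdig x i) ⊤

noncomputable def Rfun (μf : Measure ℝ) (x : ℝ) (n : ℕ) : ℝ :=
  if n = 0 then 1 else (μf (dyadI x n)).toReal

/-- The Möbius action of `M` has positive denominator on `[α, β]`, maps this interval to itself,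
and is monotone there. -/
def PhiStable (α β : ℝ) (M : Matrix (Fin 2) (Fin 2) ℝ) : Prop :=
  (∀ z ∈ Icc α β, 0 < M 1 0 * z + M 1 1) ∧ MapsTo (PhiM M) (Icc α β) (Icc α β) ∧
    MonotoneOn (PhiM M) (Icc α β)

theorem PhiStable.one (α β : ℝ) : PhiStable α β 1 := by
  have h : PhiM 1 = id := by
    ext z
    simp [PhiM]
  refine ⟨fun z _ => by simp, ?_, ?_⟩
  · rw [h]
    exact mapsTo_id _
  · rw [h]
    exact monotoneOn_id

theorem den_mul (M N : Matrix (Fin 2) (Fin 2) ℝ) {z : ℝ} (h : N 1 0 * z + N 1 1 ≠ 0) :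
    (M * N) 1 0 * z + (M * N) 1 1 =
      (M 1 0 * PhiM N z + M 1 1) * (N 1 0 * z + N 1 1) := by
  have hN : PhiM N z * (N 1 0 * z + N 1 1) = N 0 0 * z + N 0 1 := div_mul_cancel₀ _ h
  simp only [Matrix.mul_apply, Fin.sum_univ_two]
  linear_combination -M 1 0 * hN

theorem PhiM_mul (M N : Matrix (Fin 2) (Fin 2) ℝ) {z : ℝ} (h : N 1 0 * z + N 1 1 ≠ 0) :
    PhiM (M * N) z = PhiM M (PhiM N z) := by
  have hnum : (M * N) 0 0 * z + (M * N) 0 1 =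
      (M 0 0 * PhiM N z + M 0 1) * (N 1 0 * z + N 1 1) := by
    have hN : PhiM N z * (N 1 0 * z + N 1 1) = N 0 0 * z + N 0 1 := div_mul_cancel₀ _ h
    simp only [Matrix.mul_apply, Fin.sum_univ_two]
    linear_combination -M 0 0 * hN
  rw [PhiM, hnum, den_mul M N h, mul_div_mul_right _ _ h, ← PhiM]

theorem PhiStable.mul {α β : ℝ} {M N : Matrix (Fin 2) (Fin 2) ℝ} (hM : PhiStable α β M)
    (hN : PhiStable α β N) : PhiStable α β (M * N) := by
  obtain ⟨hM₁, hM₂, hM₃⟩ := hM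
  obtain ⟨hN₁, hN₂, hN₃⟩ := hN
  have heq : EqOn (PhiM M ∘ PhiM N) (PhiM (M * N)) (Icc α β) := fun z hz =>
    (PhiM_mul M N (hN₁ z hz).ne').symm
  refine ⟨fun z hz => ?_, (hM₂.comp hN₂).congr heq, (hM₃.comp hN₃ hN₂).congr heq⟩
  rw [den_mul M N (hN₁ z hz).ne']
  exact mul_pos (hM₁ _ (hN₂ hz)) (hN₁ z hz)

/-- A Möbius map with positive determinant and denominator is stable on an interval as soon as it
moves both endpoints inwards. -/
theorem PhiStable.of_endpoints {α β : ℝ} (hαβ : α ≤ β) {a b c d : ℝ}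
    (hdet : 0 < a * d - b * c) (hden : ∀ z ∈ Icc α β, 0 < c * z + d)
    (hα : α * (c * α + d) ≤ a * α + b) (hβ : a * β + b ≤ β * (c * β + d)) :
    PhiStable α β !![a, b; c, d] := by
  have hmono : MonotoneOn (PhiM !![a, b; c, d]) (Icc α β) := by
    intro z hz w hw hzw
    simp only [PhiM, Matrix.of_apply, Matrix.cons_val', Matrix.cons_val_zero,
      Matrix.cons_val_one, Matrix.cons_val_fin_one]
    rw [div_le_div_iff₀ (hden z hz) (hden w hw)]
    nlinarith [mul_nonneg hdet.le (sub_nonneg.2 hzw)]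
  refine ⟨fun z hz => by simpa using hden z hz, fun z hz => ⟨?_, ?_⟩, hmono⟩
  · refine le_trans ?_ (hmono (left_mem_Icc.2 hαβ) hz hz.1)
    simpa [PhiM] using (le_div_iff₀ (hden α (left_mem_Icc.2 hαβ))).2 hα
  · refine (hmono hz (right_mem_Icc.2 hαβ) hz.2).trans ?_
    simpa [PhiM] using (div_le_iff₀ (hden β (right_mem_Icc.2 hαβ))).2 hβ

theorem PhiStable.transpose_prod_map {α β : ℝ} {ι : Type*} (B : ι → Matrix (Fin 2) (Fin 2) ℝ)
    (l : List ι) (h : ∀ j ∈ l, PhiStable α β (B j)ᵀ) : PhiStable α β (l.map B).prodᵀ := by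
  induction l with
  | nil => simpa using PhiStable.one α β
  | cons j l ih =>
    rw [List.map_cons, List.prod_cons, Matrix.transpose_mul]
    exact (ih fun k hk => h k (List.mem_cons_of_mem j hk)).mul (h j List.mem_cons_self)

theorem Xdig_succ_eq_zero_or_one {x : ℝ} (hx : 0 ≤ x) (n : ℕ) :
    Xdig x (n + 1) = 0 ∨ Xdig x (n + 1) = 1 := by
  have hlt : ⌊(2 : ℝ) ^ (n + 1) * x⌋₊ < 2 * ⌊(2 : ℝ) ^ n * x⌋₊ + 2 := by
    rw [Nat.floor_lt (by positivity)]
    have := Nat.lt_floor_add_one ((2 : ℝ) ^ n * x)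
    push_cast
    rw [pow_succ]
    linarith
  simp only [Xdig, Nat.add_sub_cancel]
  omega

theorem stmt13
    (a0 b0 c0 d0 a1 b1 c1 d1 : ℝ)
    (hb0 : b0 = 0)
    (hA1a : 0 < (a0 + b0) / (c0 + d0))
    (hA1b : (a0 + b0) / (c0 + d0) = b1 / d1)
    (hA1c : b1 / d1 < (a1 + b1) / (c1 + d1))
    (hA1d : (a1 + b1) / (c1 + d1) = 1)
    (hA20 : 0 < a0 * d0 - b0 * c0)
    (hA21 : 0 < a1 * d1 - b1 * c1)
    (hA30 : Real.sqrt (a0 * d0 - b0 * c0) < min d0 (c0 + d0))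
    (hA31 : Real.sqrt (a1 * d1 - b1 * c1) < min d1 (c1 + d1))
    (α : ℝ) (hα : α = min (min 0 (c0 / (d0 - a0))) (c1 / b1))
    (β : ℝ) (hβ : β = max (max 0 (c0 / (d0 - a0))) (c1 / b1))
    (A : ℕ → Matrix (Fin 2) (Fin 2) ℝ)
    (hAm0 : A 0 = !![a0, b0; c0, d0])
    (hAm1 : A 1 = !![a1, b1; c1, d1])
    :
    (∀ n : ℕ, 1 ≤ n → ∀ i : ℕ → ℕ, (∀ j, i j = 0 ∨ i j = 1) →
      α ≤ PhiM (((List.range n).map (fun j => A (i j))).prod)ᵀ α ∧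
      PhiM (((List.range n).map (fun j => A (i j))).prod)ᵀ α ≤
        PhiM (((List.range n).map (fun j => A (i j))).prod)ᵀ β ∧
      PhiM (((List.range n).map (fun j => A (i j))).prod)ᵀ β ≤ β) ∧
    (∀ n : ℕ, 1 ≤ n → ∀ x ∈ Set.Ico (0 : ℝ) 1,
      matProd A x n 1 0 / matProd A x n 1 1 ∈ Set.Icc α β) := by
  subst hb0
  rw [lt_min_iff] at hA30 hA31
  obtain ⟨h0d, h0s⟩ := hA30
  obtain ⟨h1d, h1s⟩ := hA31
  have hd0 : 0 < d0 := (Real.sqrt_nonneg _).trans_lt h0d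
  have hs0 : 0 < c0 + d0 := (Real.sqrt_nonneg _).trans_lt h0s
  have hd1 : 0 < d1 := (Real.sqrt_nonneg _).trans_lt h1d
  have hs1 : 0 < c1 + d1 := (Real.sqrt_nonneg _).trans_lt h1s
  rw [Real.sqrt_lt' hd0] at h0d
  rw [Real.sqrt_lt' hs1] at h1s
  have hsum : a1 + b1 = c1 + d1 := (div_eq_one_iff_eq hs1.ne').1 hA1d
  have hb1 : 0 < b1 := by
    rw [hA1b] at hA1a
    exact (div_pos_iff_of_pos_right hd1).1 hA1a
  rw [hA1d] at hA1c
  have hbd : b1 < d1 := (div_lt_one hd1).1 hA1c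
  have hac : a0 < c0 + d0 := by
    rw [← hA1b, div_lt_one hs0] at hA1c
    linarith
  have had : 0 < d0 - a0 := by nlinarith
  have ha1 : a1 = c1 + d1 - b1 := by linarith
  have hbc : 0 < b1 + c1 := by
    subst ha1
    nlinarith
  set p := c0 / (d0 - a0) with hp
  set q := c1 / b1 with hq
  have hc0 : c0 = p * (d0 - a0) := (div_mul_cancel₀ _ had.ne').symm
  have hc1 : c1 = q * b1 := (div_mul_cancel₀ _ hb1.ne').symm
  have hp1 : -1 < p := by
    rw [hp, lt_div_iff₀ had]
    linarith
  have hq1 : -1 < q := by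
    rw [hq, lt_div_iff₀ hb1]
    linarith
  have hα0 : α ≤ 0 := by simp [hα]
  have hαp : α ≤ p := by simp [hα]
  have hαq : α ≤ q := by simp [hα]
  have hβ0 : 0 ≤ β := by simp [hβ]
  have hβp : p ≤ β := by simp [hβ]
  have hβq : q ≤ β := by simp [hβ]
  have hα1 : -1 < α := by
    rw [hα]
    exact lt_min (lt_min (by norm_num) hp1) hq1
  have hαβ : α ≤ β := hα0.trans hβ0
  have hA0 : PhiStable α β (A 0)ᵀ := by
    have hT : (A 0)ᵀ = !![a0, c0; 0, d0] := by
      rw [hAm0]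
      ext i j
      fin_cases i <;> fin_cases j <;> rfl
    rw [hT]
    refine PhiStable.of_endpoints hαβ (by linarith) (fun z _ => by linarith) ?_ ?_
    · nlinarith [mul_nonneg (sub_nonneg.2 hαp) had.le]
    · nlinarith [mul_nonneg (sub_nonneg.2 hβp) had.le]
  have hA1 : PhiStable α β (A 1)ᵀ := by
    have hT : (A 1)ᵀ = !![a1, c1; b1, d1] := by
      rw [hAm1]
      ext i j
      fin_cases i <;> fin_cases j <;> rfl
    rw [hT]
    refine PhiStable.of_endpoints hαβ (by linarith) (fun z hz => ?_) ?_ ?_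
    · nlinarith [hz.1]
    · have h := mul_nonneg (mul_nonneg hb1.le (sub_nonneg.2 hαq)) (by linarith : 0 ≤ α + 1)
      have hfac : a1 * α + c1 - α * (b1 * α + d1) = b1 * (q - α) * (α + 1) := by
        rw [ha1, hc1]
        ring
      linarith
    · have h := mul_nonneg (mul_nonneg hb1.le (sub_nonneg.2 hβq)) (by linarith : 0 ≤ β + 1)
      have hfac : β * (b1 * β + d1) - (a1 * β + c1) = b1 * (β - q) * (β + 1) := by
        rw [ha1, hc1]
        ring
      linarith
  have hA : ∀ k, k = 0 ∨ k = 1 → PhiStable α β (A k)ᵀ := by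
    rintro k (rfl | rfl)
    exacts [hA0, hA1]
  refine ⟨fun n _ i hi => ?_, fun n _ x hx => ?_⟩
  · obtain ⟨-, hmaps, hmono⟩ := PhiStable.transpose_prod_map (fun j => A (i j)) (List.range n)
      fun j _ => hA _ (hi j)
    have hl : α ∈ Icc α β := left_mem_Icc.2 hαβ
    have hr : β ∈ Icc α β := right_mem_Icc.2 hαβ
    exact ⟨(hmaps hl).1, hmono hl hr hαβ, (hmaps hr).2⟩
  · obtain ⟨-, hmaps, -⟩ := PhiStable.transpose_prod_map (fun j => A (Xdig x (j + 1)))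
      (List.range n) fun j _ => hA _ (Xdig_succ_eq_zero_or_one hx.1 j)
    simpa [PhiM, matProd] using hmaps (show (0 : ℝ) ∈ Icc α β from ⟨hα0, hβ0⟩)
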